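/- Solution mapping in the Pigeon-to-Index reduction: let n ≥ 1, N = 2^{n+2}, and C : {0,1}^n → {0,1}^n. Suppose I : [N] → ℕ satisfies: I(a) = a + 2^n for all a < 2^{n+1}; I(a) = 2^{n+1} + a/2 for all even a with 2^{n+1} ≤ a < N; and I(a) = val(C(bits_n((a−1)/2 − 2^n))) for all odd a with 2^{n+1} ≤ a < N. Then: (a) for every u ∈ [N] with I(u) = 0 there exists x ∈ {0,1}^n with C(x) = 0^n; (b) for all u, v ∈ [N] with u ≠ v and I(u) = I(v), there exist distinct a, b ∈ {0,1}^n with C(a) = C(b). -/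

import Mathlib

/-- The number whose binary expansion (most significant bit first) is `u`. -/
def valS {n : ℕ} (u : Fin n → Bool) : ℕ :=
  (List.ofFn u).foldl (fun a b => 2*a + (if b then 1 else 0)) 0

/-- The length-`n` binary expansion (most significant bit first) of `m`. -/
def bitsS (n : ℕ) (m : ℕ) : Fin n → Bool := fun i => m.testBit (n - 1 - (i : ℕ))

theorem valS_succ {n : ℕ} (u : Fin (n + 1) → Bool) :
    valS u = 2 * valS (fun i : Fin n => u i.castSucc) + (if u (Fin.last n) then 1 else 0) := by
  unfold valS
  rw [List.ofFn_succ', List.concat_eq_append, List.foldl_append, List.foldl_cons, List.foldl_nil]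

theorem valS_lt_two_pow {n : ℕ} (u : Fin n → Bool) : valS u < 2 ^ n := by
  induction n with
  | zero => simp [valS]
  | succ n ih =>
    have h := ih fun i => u i.castSucc
    rw [valS_succ, pow_succ]
    split <;> omega

theorem valS_injective (n : ℕ) : Function.Injective (valS : (Fin n → Bool) → ℕ) := by
  induction n with
  | zero => exact fun u v _ => Subsingleton.elim u v
  | succ n ih =>
    intro u v h
    rw [valS_succ, valS_succ] at h
    have hlast : u (Fin.last n) = v (Fin.last n) := by
      cases hu : u (Fin.last n) <;> cases hv : v (Fin.last n) <;> simp [hu, hv] at h ⊢ <;> omega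
    have hinit : (fun i : Fin n => u i.castSucc) = fun i => v i.castSucc := by
      apply ih
      rw [hlast] at h
      omega
    funext i
    induction i using Fin.lastCases with
    | last => exact hlast
    | cast i => exact congrFun hinit i

theorem valS_const_false (n : ℕ) : valS (fun _ : Fin n => false) = 0 := by
  induction n with
  | zero => simp [valS]
  | succ n ih => simp [valS_succ, ih]

theorem bitsS_injOn (n : ℕ) : Set.InjOn (bitsS n) (Set.Iio (2 ^ n)) := by
  intro a ha b hb h
  apply Nat.eq_of_testBit_eq
  intro i
  by_cases hi : i < n
  · have := congrFun h ⟨n - 1 - i, by omega⟩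
    simpa [bitsS, show n - 1 - (n - 1 - i) = i by omega] using this
  · have hpow : 2 ^ n ≤ 2 ^ i := Nat.pow_le_pow_right (by omega) (by omega)
    rw [Nat.testBit_lt_two_pow (lt_of_lt_of_le ha hpow),
      Nat.testBit_lt_two_pow (lt_of_lt_of_le hb hpow)]

theorem pigeon_to_index_solutions (n : ℕ) (hn : 1 ≤ n)
    (C : (Fin n → Bool) → Fin n → Bool) (I : ℕ → ℕ)
    (h1 : ∀ a < 2^(n+1), I a = a + 2^n)
    (h2 : ∀ a, 2^(n+1) ≤ a → a < 2^(n+2) → a % 2 = 0 → I a = 2^(n+1) + a / 2)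
    (h3 : ∀ a, 2^(n+1) ≤ a → a < 2^(n+2) → a % 2 = 1 →
      I a = valS (C (bitsS n ((a - 1) / 2 - 2^n)))) :
    (∀ u < 2^(n+2), I u = 0 → ∃ x : Fin n → Bool, C x = fun _ => false) ∧
    (∀ u < 2^(n+2), ∀ v < 2^(n+2), u ≠ v → I u = I v →
      ∃ a b : Fin n → Bool, a ≠ b ∧ C a = C b) := by
  have p1 : 2 ^ (n + 1) = 2 * 2 ^ n := by ring
  have p2 : 2 ^ (n + 2) = 4 * 2 ^ n := by ring
  have hpos : 0 < 2 ^ n := by positivity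
  have odd_of_lt : ∀ a < 2 ^ (n + 2), I a < 2 ^ n → 2 ^ (n + 1) ≤ a ∧ a % 2 = 1 := by
    intro a ha hI
    have hge : 2 ^ (n + 1) ≤ a := by
      by_contra hlt
      have := h1 a (by omega)
      omega
    refine ⟨hge, ?_⟩
    by_contra hodd
    have := h2 a hge ha (by omega)
    omega
  constructor
  · intro u hu h0
    obtain ⟨hge, hodd⟩ := odd_of_lt u hu (by omega)
    refine ⟨_, valS_injective n ((h3 u hge hu hodd).symm.trans ?_)⟩
    rw [h0, valS_const_false]
  · intro u hu v hv huv hI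
    by_cases hlt : I u < 2 ^ n
    · obtain ⟨hug, huo⟩ := odd_of_lt u hu hlt
      obtain ⟨hvg, hvo⟩ := odd_of_lt v hv (hI ▸ hlt)
      refine ⟨bitsS n ((u - 1) / 2 - 2 ^ n), bitsS n ((v - 1) / 2 - 2 ^ n), fun h => ?_,
        valS_injective n ?_⟩
      · have := bitsS_injOn n (Set.mem_Iio.2 (by omega)) (Set.mem_Iio.2 (by omega)) h
        omega
      · rw [← h3 u hug hu huo, ← h3 v hvg hv hvo, hI]
    · have cases_of_ge : ∀ a < 2 ^ (n + 2), 2 ^ n ≤ I a →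
          (a < 2 ^ (n + 1) ∧ I a = a + 2 ^ n) ∨
          (2 ^ (n + 1) ≤ a ∧ a % 2 = 0 ∧ I a = 2 ^ (n + 1) + a / 2) := by
        intro a ha hIa
        by_cases hsmall : a < 2 ^ (n + 1)
        · exact Or.inl ⟨hsmall, h1 a hsmall⟩
        · have hge : 2 ^ (n + 1) ≤ a := by omega
          have heven : a % 2 = 0 := by
            by_contra hodd
            have hIv := h3 a hge ha (by omega)
            have := valS_lt_two_pow (C (bitsS n ((a - 1) / 2 - 2 ^ n)))
            omega
          exact Or.inr ⟨hge, heven, h2 a hge ha heven⟩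
      have hcu := cases_of_ge u hu (by omega)
      have hcv := cases_of_ge v hv (by omega)
      omega
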